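/- Let 0 < β < 1, p(n) = n^{−β}, and let k be a positive integer. For each n fix a total order on the potential edges of a graph on {1,…,n}, and define γ_ℓ(G) for a graph G on n vertices recursively by γ_0(G) = 1 and γ_ℓ(G) = f_{ℓ−1}(G) − [t^{n−1−ℓ}] Σ_{i=0}^{ℓ−1} γ_i(G)·(t+1)^i·(t+2)^{n−1−2i} for ℓ ≥ 1, where [t^m] denotes the coefficient of t^m in a polynomial. Then there exist constants 0 < c < C (depending on β and k) such that lim_{n→∞} P( c·n^{(2−β)ℓ} ≤ γ_ℓ(G) ≤ C·n^{(2−β)ℓ} for all 0 ≤ ℓ ≤ k ) = 1 for the Erdős–Rényi random graph G ∈ G(n,p(n)); in particular, asymptotically almost surely γ_ℓ(G) > 0 for all 1 ≤ ℓ ≤ k. -/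

import Mathlib

open SimpleGraph Finset Filter

namespace SEP

/-- The vector `e_i - e_j` in `ℝ^n`. -/
def eVec {n : ℕ} (i j : Fin n) : Fin n → ℝ :=
  fun t => (if t = i then 1 else 0) - (if t = j then 1 else 0)

/-- The symmetric edge polytope of a graph on `Fin n`. -/
def symEdgePolytope {n : ℕ} (G : SimpleGraph (Fin n)) : Set (Fin n → ℝ) :=
  convexHull ℝ {x | ∃ i j, G.Adj i j ∧ x = eVec i j}

/-- Both darts `a` and `b` are arcs of a common directed cycle of length `m` of `G`. -/
def dartsInCycle {V : Type*} (G : SimpleGraph V) (a b : G.Dart) (m : ℕ) : Prop :=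
  ∃ (u : V) (w : G.Walk u u), w.IsCycle ∧ w.length = m ∧ a ∈ w.darts ∧ b ∈ w.darts

/-- `F` is a face of the polytope `P`: the set of maximizers of some linear functional. -/
def IsFaceOfPolytope {n : ℕ} (P F : Set (Fin n → ℝ)) : Prop :=
  ∃ a : Fin n → ℝ,
    F = {x | x ∈ P ∧ ∀ y ∈ P, ∑ t, a t * y t ≤ ∑ t, a t * x t}

/-- Dimension of (the affine span of) a subset of `ℝ^n`. -/
noncomputable def polyDim {n : ℕ} (s : Set (Fin n → ℝ)) : ℕ :=
  Module.finrank ℝ (vectorSpan ℝ s)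

/-- `v` is a vertex of the polytope `P`. -/
def IsVertexOfPolytope {n : ℕ} (P : Set (Fin n → ℝ)) (v : Fin n → ℝ) : Prop :=
  IsFaceOfPolytope P {v}

/-- `F` is an edge (a 1-dimensional face) of the polytope `P`. -/
def IsEdgeOfPolytope {n : ℕ} (P F : Set (Fin n → ℝ)) : Prop :=
  IsFaceOfPolytope P F ∧ polyDim F = 1

/-- A polytope is simple if every vertex lies on exactly `dim P` edges. -/
def IsSimplePolytope {n : ℕ} (P : Set (Fin n → ℝ)) : Prop :=
  ∀ v, IsVertexOfPolytope P v →
    Set.ncard {F : Set (Fin n → ℝ) | IsEdgeOfPolytope P F ∧ v ∈ F} = polyDim P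

/-- Two disjoint edges, on four vertices. -/
def twoDisjointEdges : SimpleGraph (Fin 4) :=
  SimpleGraph.fromEdgeSet {s(0, 1), s(2, 3)}

/-- The cyclomatic number `|E| - |V| + c` of a graph, as an integer. -/
noncomputable def cyc {V : Type*} (G : SimpleGraph V) : ℤ :=
  (G.edgeSet.ncard : ℤ) + Nat.card G.ConnectedComponent - Nat.card V

/-- A graph is 2-connected: connected, with at least 3 vertices, and deleting any
single vertex leaves it connected. -/
def TwoConnected {V : Type*} (G : SimpleGraph V) : Prop :=
  G.Connected ∧ 3 ≤ Nat.card V ∧ ∀ v : V, (G.induce {u | u ≠ v}).Connected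

/-- The subgraph `H` consists of a single edge of `G`. -/
def IsSingleEdge {V : Type*} (G : SimpleGraph V) (H : G.Subgraph) : Prop :=
  ∃ (u v : V) (h : G.Adj u v), H = G.subgraphOfAdj h

/-- `H` is a 2-connected component (block) of `G`: an inclusion-maximal subgraph that is
2-connected or a single edge. -/
def IsBlock {V : Type*} (G : SimpleGraph V) (H : G.Subgraph) : Prop :=
  (TwoConnected H.coe ∨ IsSingleEdge G H) ∧
    ∀ H' : G.Subgraph, H ≤ H' → (TwoConnected H'.coe ∨ IsSingleEdge G H') → H' = H

/-- A pair of darts (oriented edges) of `G`, with distinct underlying edges, is *bad*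
with respect to the order `elt` on edges. -/
def BadPair {V : Type*} (G : SimpleGraph V) (elt : Sym2 V → Sym2 V → Prop)
    (a b : G.Dart) : Prop :=
  a.edge ≠ b.edge ∧
    (dartsInCycle G a b 3 ∨
      ∃ (u : V) (w : G.Walk u u), w.IsCycle ∧ w.length = 4 ∧ a ∈ w.darts ∧ b ∈ w.darts ∧
        (∃ e ∈ w.edges, elt e a.edge) ∧ (∃ e ∈ w.edges, elt e b.edge))

/-- `n₁(G, <)`: the number of (unordered) bad pairs of oriented edges. -/
noncomputable def n1 {V : Type*} (G : SimpleGraph V) (elt : Sym2 V → Sym2 V → Prop) : ℕ :=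
  Set.ncard {z : Sym2 G.Dart | ∃ a b, BadPair G elt a b ∧ z = s(a, b)}

/-- `γ₂(G, <) = 2 cy(G)(cy(G)+2) - n₁(G, <)`. -/
noncomputable def gammaTwo {V : Type*} (G : SimpleGraph V)
    (elt : Sym2 V → Sym2 V → Prop) : ℤ :=
  2 * cyc G * (cyc G + 2) - (n1 G elt : ℤ)

/-- Restriction of an order on `Sym2 V` to `Sym2 s` for `s : Set V`. -/
def restrictOrd {V : Type*} (elt : Sym2 V → Sym2 V → Prop) (s : Set V) :
    Sym2 s → Sym2 s → Prop :=
  fun e₁ e₂ => elt (e₁.map Subtype.val) (e₂.map Subtype.val)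

/-- The graph `G_n` on `Fin n`: vertices `0` and `1` are adjacent to everything. -/
def GnGraph (n : ℕ) : SimpleGraph (Fin n) :=
  SimpleGraph.fromRel (fun a _ => a.val < 2)

/-- The complete bipartite graph `K_{2, n-2}` on `Fin n`, with parts `{0,1}` and the rest. -/
def K2Graph (n : ℕ) : SimpleGraph (Fin n) :=
  SimpleGraph.fromRel (fun a b => a.val < 2 ∧ 2 ≤ b.val)

/-- A set `S` of darts of `G` is a face of the triangulation `Δ_<` of `∂P_G`. -/
def IsFace {V : Type*} (G : SimpleGraph V) (elt : Sym2 V → Sym2 V → Prop)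
    (S : Set G.Dart) : Prop :=
  (¬ ∃ d ∈ S, d.symm ∈ S) ∧
    ∀ ℓ : ℕ, 2 ≤ ℓ → ∀ (u : V) (w : G.Walk u u), w.IsCycle →
      (w.length = 2 * ℓ - 1 → Set.ncard {d ∈ S | d ∈ w.darts} < ℓ) ∧
      (w.length = 2 * ℓ →
        Set.ncard {d ∈ S | d ∈ w.darts ∧ ∃ e ∈ w.edges, elt e d.edge} < ℓ)

/-- The face complex `Δ_<` of `(G, <)`. -/
def faceCx {V : Type*} (G : SimpleGraph V) (elt : Sym2 V → Sym2 V → Prop) :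
    Set (Set G.Dart) :=
  {S | IsFace G elt S}

/-- The join of two simplicial complexes (given as families of faces on disjoint
vertex types). -/
def joinCx {A B : Type*} (F : Set (Set A)) (H : Set (Set B)) : Set (Set (A ⊕ B)) :=
  {S | ∃ F₁ ∈ F, ∃ H₁ ∈ H, S = Sum.inl '' F₁ ∪ Sum.inr '' H₁}

/-- The complex consisting of two disjoint vertices. -/
def twoPtCx : Set (Set (Fin 2)) :=
  {S | S = ∅ ∨ S = {0} ∨ S = {1}}

/-- Contraction of the edge `{v, w}` of a simplicial complex; `v` is identified with `w`. -/
def contractCx {A : Type*} (F : Set (Set A)) (v w : A) : Set (Set A) :=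
  {S | (S ∈ F ∧ v ∉ S) ∨ ∃ H ∈ F, v ∈ H ∧ S = (H \ {v}) ∪ {w}}

/-- Isomorphism of simplicial complexes: a bijection of vertex sets inducing a bijection
of faces. -/
def CxIso {A B : Type*} (F : Set (Set A)) (H : Set (Set B)) : Prop :=
  ∃ φ : A → B, Set.BijOn φ (⋃₀ F) (⋃₀ H) ∧
    (∀ S ∈ F, φ '' S ∈ H) ∧ (∀ T ∈ H, ∃ S ∈ F, φ '' S = T)

/-! ### Erdős–Rényi random graphs -/

/-- The probability weight of a fixed graph `G` in the Erdős–Rényi model `G(n,p)`. -/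
noncomputable def graphWeight (n : ℕ) (p : ℝ) (G : SimpleGraph (Fin n)) : ℝ :=
  p ^ G.edgeSet.ncard * (1 - p) ^ (n.choose 2 - G.edgeSet.ncard)

/-- The probability of an event `A` in the Erdős–Rényi model `G(n,p)`. -/
noncomputable def erProb (n : ℕ) (p : ℝ) (A : Set (SimpleGraph (Fin n))) : ℝ :=
  ∑ G : SimpleGraph (Fin n), A.indicator (graphWeight n p) G

/-- The expectation of a random variable in the Erdős–Rényi model `G(n,p)`. -/
noncomputable def erExp (n : ℕ) (p : ℝ) (X : SimpleGraph (Fin n) → ℝ) : ℝ :=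
  ∑ G : SimpleGraph (Fin n), graphWeight n p G * X G

/-- The variance of a random variable in the Erdős–Rényi model `G(n,p)`. -/
noncomputable def erVar (n : ℕ) (p : ℝ) (X : SimpleGraph (Fin n) → ℝ) : ℝ :=
  erExp n p (fun G => (X G - erExp n p X) ^ 2)

/-- The number of cycles of `G` with exactly `k` vertices, counted via their edge sets. -/
noncomputable def numCycles {V : Type*} (G : SimpleGraph V) (k : ℕ) : ℕ :=
  Set.ncard {s : Set (Sym2 V) |
    ∃ (u : V) (w : G.Walk u u), w.IsCycle ∧ w.length = k ∧ s = {e | e ∈ w.edges}}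

/-- `E(X_k) = C(n,k)·((k−1)!/2)·p^k`, the expected number of `k`-cycles. -/
noncomputable def expCycles (n : ℕ) (p : ℝ) (k : ℕ) : ℝ :=
  (n.choose k : ℝ) * ((Nat.factorial (k - 1) : ℝ) / 2) * p ^ k

/-- `E(X_E) = C(n,2)·p`, the expected number of edges. -/
noncomputable def expEdges (n : ℕ) (p : ℝ) : ℝ :=
  (n.choose 2 : ℝ) * p

/-- `n_{k-1}(G)`: the number of `k`-element non-faces of `Δ_<` containing no antipodal
pair. -/
noncomputable def numNonFaces {V : Type*} (G : SimpleGraph V)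
    (elt : Sym2 V → Sym2 V → Prop) (k : ℕ) : ℕ :=
  Set.ncard {S : Set G.Dart |
    S.ncard = k ∧ (¬ ∃ d ∈ S, d.symm ∈ S) ∧ ¬ IsFace G elt S}

/-- `f_{k-1}(G)`: the number of `k`-element faces of `Δ_<`. -/
noncomputable def numFaces {V : Type*} (G : SimpleGraph V)
    (elt : Sym2 V → Sym2 V → Prop) (k : ℕ) : ℕ :=
  Set.ncard {S : Set G.Dart | S.ncard = k ∧ IsFace G elt S}

/-- The generalized binomial coefficient `binom(x, ℓ)` for real `x`. -/
noncomputable def realChoose (x : ℝ) (ℓ : ℕ) : ℝ :=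
  (∏ i ∈ Finset.range ℓ, (x - i)) / (Nat.factorial ℓ)

/-- The recursively defined γ-numbers `γ_ℓ(G)`:
`γ_0 = 1` and
`γ_ℓ = f_{ℓ−1} − [t^{n−1−ℓ}] ∑_{i<ℓ} γ_i (t+1)^i (t+2)^{n−1−2i}`. -/
noncomputable def gammaRG (n : ℕ) (G : SimpleGraph (Fin n))
    (elt : Sym2 (Fin n) → Sym2 (Fin n) → Prop) : ℕ → ℤ := fun ℓ =>
  Nat.strongRecOn ℓ (fun ℓ ih =>
    if ℓ = 0 then (1 : ℤ)
    else
      (numFaces G elt ℓ : ℤ) -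
        Polynomial.coeff
          (∑ i ∈ (Finset.range ℓ).attach,
            Polynomial.C (ih i.1 (Finset.mem_range.mp i.2)) *
              ((Polynomial.X + 1) ^ (i.1 : ℕ) *
                (Polynomial.X + 2) ^ (n - 1 - 2 * i.1) : Polynomial ℤ))
          (n - 1 - ℓ))

section Probability

variable {n : ℕ} {p : ℝ}

lemma graphWeight_nonneg (hp0 : 0 ≤ p) (hp1 : p ≤ 1) (G : SimpleGraph (Fin n)) :
    0 ≤ graphWeight n p G :=
  mul_nonneg (pow_nonneg hp0 _) (pow_nonneg (sub_nonneg.2 hp1) _)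

open Classical in
/-- A sum over all graphs is a sum over all sets of potential edges. -/
lemma sum_simpleGraph_eq_sum_powerset (f : Finset (Sym2 (Fin n)) → ℝ) :
    ∑ G : SimpleGraph (Fin n), f G.edgeFinset =
      ∑ s ∈ (⊤ : SimpleGraph (Fin n)).edgeFinset.powerset, f s := by
  refine Finset.sum_bij' (fun G _ => G.edgeFinset) (fun s _ => fromEdgeSet (s : Set (Sym2 (Fin n))))
    ?_ ?_ ?_ ?_ ?_
  · intro G _
    rw [Finset.mem_powerset, edgeFinset_subset_edgeFinset]
    exact le_top
  · simp
  · intro G _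
    simp
  · intro s hs
    rw [Finset.mem_powerset] at hs
    ext e
    have : e ∈ s → ¬ e.IsDiag := fun h => by simpa using hs h
    simpa using this
  · simp

open Classical in
/-- The probability that a fixed set of potential edges is contained in the random graph. -/
lemma sum_graphWeight_subset {A : Finset (Sym2 (Fin n))}
    (hA : A ⊆ (⊤ : SimpleGraph (Fin n)).edgeFinset) :
    ∑ G : SimpleGraph (Fin n), graphWeight n p G * (if A ⊆ G.edgeFinset then 1 else 0) =
      p ^ A.card := by
  set U := (⊤ : SimpleGraph (Fin n)).edgeFinset with hU
  have hUc : U.card = n.choose 2 := by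
    rw [hU, card_edgeFinset_top_eq_card_choose_two, Fintype.card_fin]
  have h1 := sum_simpleGraph_eq_sum_powerset (n := n) fun s =>
    p ^ s.card * (1 - p) ^ (n.choose 2 - s.card) * (if A ⊆ s then 1 else 0)
  simp only [graphWeight, Set.ncard_eq_toFinset_card']
  refine h1.trans ?_
  simp only [mul_ite, mul_one, mul_zero]
  rw [← Finset.sum_filter]
  have h2 : ∑ t ∈ (U \ A).powerset, p ^ t.card * (1 - p) ^ ((U \ A).card - t.card) = 1 := by
    rw [Finset.sum_pow_mul_eq_add_pow]; simp
  calc _ = ∑ t ∈ (U \ A).powerset,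
        p ^ A.card * (p ^ t.card * (1 - p) ^ ((U \ A).card - t.card)) := by
        refine Finset.sum_bij' (fun s _ => s \ A) (fun t _ => A ∪ t) ?_ ?_ ?_ ?_ ?_
        · intro s hs
          simp only [Finset.mem_filter, Finset.mem_powerset] at hs ⊢
          exact Finset.sdiff_subset_sdiff hs.1 le_rfl
        · intro t ht
          simp only [Finset.mem_filter, Finset.mem_powerset] at ht ⊢
          exact ⟨Finset.union_subset hA (ht.trans Finset.sdiff_subset), Finset.subset_union_left⟩
        · intro s hs
          simp only [Finset.mem_filter, Finset.mem_powerset] at hs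
          exact Finset.union_sdiff_of_subset hs.2
        · intro t ht
          simp only [Finset.mem_powerset] at ht
          have : Disjoint t A := Finset.disjoint_of_subset_left ht Finset.sdiff_disjoint
          rw [Finset.union_sdiff_cancel_left this.symm]
        · intro s hs
          simp only [Finset.mem_filter, Finset.mem_powerset] at hs
          have e1 : (s \ A).card + A.card = s.card := Finset.card_sdiff_add_card_eq_card hs.2
          have e2 : (U \ A).card + A.card = U.card := Finset.card_sdiff_add_card_eq_card hA
          rw [← mul_assoc, ← pow_add, ← hUc]
          congr 2 <;> omega
    _ = p ^ A.card := by rw [← Finset.mul_sum, h2, mul_one]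

lemma sum_graphWeight : ∑ G : SimpleGraph (Fin n), graphWeight n p G = 1 := by
  classical
  simpa using sum_graphWeight_subset (n := n) (p := p) (A := ∅) (Finset.empty_subset _)

lemma erProb_mono (hp0 : 0 ≤ p) (hp1 : p ≤ 1) {A B : Set (SimpleGraph (Fin n))} (h : A ⊆ B) :
    erProb n p A ≤ erProb n p B :=
  Finset.sum_le_sum fun G _ =>
    Set.indicator_le_indicator_of_subset h (graphWeight_nonneg hp0 hp1) G

lemma erProb_le_one (hp0 : 0 ≤ p) (hp1 : p ≤ 1) (A : Set (SimpleGraph (Fin n))) :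
    erProb n p A ≤ 1 := by
  refine (erProb_mono hp0 hp1 (Set.subset_univ A)).trans ?_
  simp [erProb, sum_graphWeight]

lemma erProb_compl (A : Set (SimpleGraph (Fin n))) : erProb n p Aᶜ = 1 - erProb n p A := by
  rw [eq_sub_iff_add_eq, erProb, erProb, ← Finset.sum_add_distrib, ← sum_graphWeight (n := n)]
  exact Finset.sum_congr rfl fun G _ => by
    rw [← Pi.add_apply, Set.indicator_compl_add_self]

lemma erProb_union_le (hp0 : 0 ≤ p) (hp1 : p ≤ 1) (A B : Set (SimpleGraph (Fin n))) :
    erProb n p (A ∪ B) ≤ erProb n p A + erProb n p B := by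
  rw [erProb, erProb, erProb, ← Finset.sum_add_distrib]
  refine Finset.sum_le_sum fun G _ => ?_
  have := graphWeight_nonneg hp0 hp1 G
  by_cases hA : G ∈ A <;> by_cases hB : G ∈ B <;> simp [hA, hB, this]

lemma erProb_biUnion_le (hp0 : 0 ≤ p) (hp1 : p ≤ 1) {ι : Type*} (s : Finset ι)
    (A : ι → Set (SimpleGraph (Fin n))) :
    erProb n p (⋃ i ∈ s, A i) ≤ ∑ i ∈ s, erProb n p (A i) := by
  classical
  induction s using Finset.induction_on with
  | empty => simp [erProb]
  | insert a s ha ih =>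
    rw [Finset.set_biUnion_insert, Finset.sum_insert ha]
    exact (erProb_union_le hp0 hp1 _ _).trans (by gcongr)

/-- Markov's inequality in `G(n,p)`. -/
lemma erProb_lt_mul_le (hp0 : 0 ≤ p) (hp1 : p ≤ 1) {X : SimpleGraph (Fin n) → ℝ}
    (hX : ∀ G, 0 ≤ X G) (t : ℝ) :
    erProb n p {G | t < X G} * t ≤ erExp n p X := by
  rw [erProb, erExp, Finset.sum_mul]
  refine Finset.sum_le_sum fun G _ => ?_
  have hw := graphWeight_nonneg hp0 hp1 G
  by_cases h : t < X G
  · simpa [h] using mul_le_mul_of_nonneg_left h.le hw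
  · simpa [h] using mul_nonneg hw (hX G)

/-- The number of edges of a graph, as a real number. -/
noncomputable def numEdges (G : SimpleGraph (Fin n)) : ℝ := G.edgeSet.ncard

open Classical in
lemma numEdges_eq_sum (G : SimpleGraph (Fin n)) :
    numEdges G = ∑ e ∈ (⊤ : SimpleGraph (Fin n)).edgeFinset,
      (if {e} ⊆ G.edgeFinset then 1 else 0) := by
  have : (⊤ : SimpleGraph (Fin n)).edgeFinset.filter (fun e => {e} ⊆ G.edgeFinset) =
      G.edgeFinset := by
    ext e
    simp only [Finset.mem_filter, Finset.singleton_subset_iff, and_iff_right_iff_imp]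
    exact fun h => edgeFinset_mono le_top h
  rw [← Finset.sum_filter, this, numEdges, Set.ncard_eq_toFinset_card', ← edgeFinset]
  simp

lemma erExp_numEdges : erExp n p numEdges = n.choose 2 * p := by
  classical
  simp only [erExp, numEdges_eq_sum, Finset.mul_sum]
  rw [Finset.sum_comm, Finset.sum_congr rfl (fun e he => sum_graphWeight_subset
    (Finset.singleton_subset_iff.2 he))]
  simp [-edgeFinset_top, card_edgeFinset_top_eq_card_choose_two]

lemma erExp_numEdges_sq_le :
    erExp n p (fun G => numEdges G ^ 2) ≤ n.choose 2 * p + (n.choose 2 * p) ^ 2 := by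
  classical
  set U := (⊤ : SimpleGraph (Fin n)).edgeFinset with hU
  have hUc : (U.card : ℝ) = n.choose 2 := by
    rw [hU, card_edgeFinset_top_eq_card_choose_two, Fintype.card_fin]
  have h1 : ∀ G : SimpleGraph (Fin n), numEdges G ^ 2 =
      ∑ e ∈ U, ∑ f ∈ U, (if {e, f} ⊆ G.edgeFinset then 1 else 0) := by
    intro G
    rw [sq, numEdges_eq_sum, Finset.sum_mul_sum]
    refine Finset.sum_congr rfl fun e _ => Finset.sum_congr rfl fun f _ => ?_
    simp only [Finset.insert_subset_iff, Finset.singleton_subset_iff]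
    split_ifs <;> simp_all
  have h2 : erExp n p (fun G => numEdges G ^ 2) =
      ∑ e ∈ U, ∑ f ∈ U, p ^ ({e, f} : Finset _).card := by
    simp only [erExp, h1, Finset.mul_sum]
    rw [Finset.sum_comm]
    refine Finset.sum_congr rfl fun e he => ?_
    rw [Finset.sum_comm]
    refine Finset.sum_congr rfl fun f hf => sum_graphWeight_subset ?_
    exact Finset.insert_subset he (Finset.singleton_subset_iff.2 hf)
  have h3 : ∀ e ∈ U, ∑ f ∈ U, p ^ ({e, f} : Finset _).card ≤ p + U.card * p ^ 2 := by
    intro e he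
    calc ∑ f ∈ U, p ^ ({e, f} : Finset _).card
        ≤ ∑ f ∈ U, ((if e = f then p else 0) + p ^ 2) := by
          refine Finset.sum_le_sum fun f _ => ?_
          by_cases h : e = f
          · subst h; simp [sq_nonneg]
          · simp [h, Finset.card_pair h]
      _ = _ := by
          rw [Finset.sum_add_distrib]; simp [he]
  rw [h2]
  refine (Finset.sum_le_sum h3).trans (le_of_eq ?_)
  rw [Finset.sum_const, nsmul_eq_mul, hUc]; ring

/-- Chebyshev's inequality for the number of edges. -/
lemma erProb_numEdges_deviation_mul_le (hp0 : 0 ≤ p) (hp1 : p ≤ 1) (t : ℝ) :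
    erProb n p {G | t < (numEdges G - n.choose 2 * p) ^ 2} * t ≤ n.choose 2 * p := by
  refine (erProb_lt_mul_le hp0 hp1 (fun G => sq_nonneg _) t).trans ?_
  set μ : ℝ := n.choose 2 * p with hμ
  have h : erExp n p (fun G => (numEdges G - μ) ^ 2) =
      erExp n p (fun G => numEdges G ^ 2) - 2 * μ * erExp n p numEdges + μ ^ 2 := by
    have := sum_graphWeight (n := n) (p := p)
    calc _ = ∑ G, (graphWeight n p G * numEdges G ^ 2 - 2 * μ * (graphWeight n p G * numEdges G)
          + μ ^ 2 * graphWeight n p G) := Finset.sum_congr rfl fun G _ => by ring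
      _ = _ := by
        rw [Finset.sum_add_distrib, Finset.sum_sub_distrib, ← Finset.mul_sum, ← Finset.mul_sum,
          this, mul_one]; rfl
  rw [h, erExp_numEdges, ← hμ]
  have := erExp_numEdges_sq_le (n := n) (p := p)
  rw [← hμ] at this
  linarith

/-- The injective maps `Fin m → Fin n` tracing a path of `G`. -/
def pathMaps (G : SimpleGraph (Fin n)) (m : ℕ) : Set (Fin m → Fin n) :=
  {c | Function.Injective c ∧ ∀ i (h : i + 1 < m), G.Adj (c ⟨i, by omega⟩) (c ⟨i + 1, h⟩)}

/-- First moment bound for the number of paths on `m` vertices. -/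
lemma erExp_ncard_pathMaps_le (hp0 : 0 ≤ p) (hp1 : p ≤ 1) (m : ℕ) :
    erExp n p (fun G => ((pathMaps G m).ncard : ℝ)) ≤ (n : ℝ) ^ m * p ^ (m - 1) := by
  classical
  have h1 : ∀ G : SimpleGraph (Fin n), ((pathMaps G m).ncard : ℝ) =
      ∑ c : Fin m → Fin n, (if c ∈ pathMaps G m then 1 else 0) := by
    intro G
    rw [Set.ncard_eq_toFinset_card', ← Finset.sum_filter]
    simp [Set.toFinset]
  simp only [erExp, h1, Finset.mul_sum]
  rw [Finset.sum_comm]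
  have h2 : ∀ c : Fin m → Fin n,
      ∑ G : SimpleGraph (Fin n), graphWeight n p G * (if c ∈ pathMaps G m then 1 else 0)
        ≤ p ^ (m - 1) := by
    intro c
    by_cases hc : Function.Injective c
    swap
    · have : ∀ G, c ∉ pathMaps G m := fun G h => hc h.1
      simp [this, pow_nonneg hp0]
    let e : Fin (m - 1) → Sym2 (Fin n) := fun i => s(c ⟨i, by omega⟩, c ⟨i + 1, by omega⟩)
    have he : Function.Injective e := by
      intro i j hij
      simp only [e, Sym2.eq_iff, hc.eq_iff, Fin.mk.injEq] at hij
      ext; omega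
    have hA : Finset.univ.image e ⊆ (⊤ : SimpleGraph (Fin n)).edgeFinset := by
      intro x hx
      obtain ⟨i, -, rfl⟩ := Finset.mem_image.1 hx
      simp [e, hc.eq_iff]
    have := sum_graphWeight_subset (p := p) hA
    rw [Finset.card_image_of_injective _ he, Finset.card_univ, Fintype.card_fin] at this
    rw [← this]
    refine Finset.sum_le_sum fun G _ => mul_le_mul_of_nonneg_left ?_ (graphWeight_nonneg hp0 hp1 G)
    by_cases h : c ∈ pathMaps G m
    · have : Finset.univ.image e ⊆ G.edgeFinset := by
        intro x hx
        obtain ⟨i, -, rfl⟩ := Finset.mem_image.1 hx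
        simpa [e] using h.2 i (by omega)
      simp [h, this]
    · rw [if_neg h]; split_ifs <;> norm_num
  refine (Finset.sum_le_sum fun c _ => h2 c).trans ?_
  simp

end Probability

section Faces

variable {n : ℕ}

lemma numFaces_le (G : SimpleGraph (Fin n)) (elt : Sym2 (Fin n) → Sym2 (Fin n) → Prop) (ℓ : ℕ) :
    numFaces G elt ℓ ≤ (2 * G.edgeSet.ncard) ^ ℓ := by
  classical
  have hsub : {S : Set G.Dart | S.ncard = ℓ ∧ IsFace G elt S} ⊆
      (((Finset.univ : Finset G.Dart).powersetCard ℓ).image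
        (fun T : Finset G.Dart => (T : Set G.Dart)) : Finset (Set G.Dart)) := by
    intro S hS
    rw [Finset.mem_coe, Finset.mem_image]
    refine ⟨S.toFinset, ?_, by simp⟩
    rw [Finset.mem_powersetCard, ← Set.ncard_eq_toFinset_card']
    exact ⟨Finset.subset_univ _, hS.1⟩
  refine (Set.ncard_le_ncard hsub (Finset.finite_toSet _)).trans ?_
  rw [Set.ncard_coe_finset]
  refine Finset.card_image_le.trans ?_
  rw [Finset.card_powersetCard, Finset.card_univ, dart_card_eq_twice_card_edges,
    Set.ncard_eq_toFinset_card', ← edgeFinset]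
  exact Nat.choose_le_pow _ _

open Classical in
/-- The darts of `G` oriented from the smaller to the larger vertex. -/
noncomputable def upDarts (G : SimpleGraph (Fin n)) : Finset G.Dart :=
  Finset.univ.filter fun d => d.fst < d.snd

lemma card_upDarts (G : SimpleGraph (Fin n)) : (upDarts G).card = G.edgeSet.ncard := by
  classical
  rw [Set.ncard_eq_toFinset_card']
  refine Finset.card_bij (fun d _ => d.edge) ?_ ?_ ?_
  · intro d _
    simp
  · intro a ha b hb hab
    simp only [upDarts, Finset.mem_filter, Finset.mem_univ, true_and] at ha hb
    rcases (dart_edge_eq_iff a b).1 hab with h | h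
    · exact h
    · subst h
      simp only [Dart.symm_toProd, Prod.fst_swap, Prod.snd_swap] at ha
      exact absurd ha hb.asymm
  · intro e he
    induction e using Sym2.ind with
    | _ x y =>
      have hxy : G.Adj x y := by simpa using he
      rcases lt_or_gt_of_ne hxy.ne with h | h
      · exact ⟨⟨(x, y), hxy⟩, by simpa [upDarts] using h, rfl⟩
      · exact ⟨⟨(y, x), hxy.symm⟩, by simpa [upDarts] using h, Sym2.eq_swap⟩

/-- The vertices of a cycle, in order, trace a path. -/
lemma getVert_mem_pathMaps {G : SimpleGraph (Fin n)} {u : Fin n} {w : G.Walk u u}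
    (hw : w.IsCycle) {m : ℕ} (hm : w.length = m) :
    (fun i : Fin m => w.getVert i) ∈ pathMaps G m := by
  refine ⟨fun i j hij => ?_, fun i hi => w.adj_getVert_succ (by omega)⟩
  have := hw.getVert_injOn' (x₁ := i) (x₂ := j) (by simp; omega) (by simp; omega) hij
  exact Fin.ext this

lemma exists_getVert_of_mem_support {G : SimpleGraph (Fin n)} {u : Fin n} {w : G.Walk u u}
    (hw : w.IsCycle) {m : ℕ} (hm : w.length = m) {x : Fin n} (hx : x ∈ w.support) :
    ∃ i : Fin m, w.getVert i = x := by
  obtain ⟨i, rfl, hi⟩ := Walk.mem_support_iff_exists_getVert.1 hx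
  have := hw.three_le_length
  rcases hi.lt_or_eq with h | h
  · exact ⟨⟨i, by omega⟩, rfl⟩
  · exact ⟨⟨0, by omega⟩, by simp [h]⟩

open Classical in
/-- The darts in `upDarts G` both of whose endpoints are values of `c`. -/
noncomputable def dartsOn (G : SimpleGraph (Fin n)) {m : ℕ} (c : Fin m → Fin n) : Finset G.Dart :=
  (upDarts G).filter fun d => (∃ i, c i = d.fst) ∧ ∃ i, c i = d.snd

lemma card_dartsOn_le (G : SimpleGraph (Fin n)) {m : ℕ} (c : Fin m → Fin n) :
    (dartsOn G c).card ≤ m * m := by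
  classical
  calc (dartsOn G c).card
      ≤ ((Finset.univ.image c) ×ˢ (Finset.univ.image c)).card := by
        refine Finset.card_le_card_of_injOn (fun d => d.toProd) ?_ ?_
        · intro d hd
          simp only [dartsOn, Finset.coe_filter, Set.mem_ofPred_eq] at hd
          simpa using hd.2
        · intro a _ b _ hab
          exact Dart.ext _ _ hab
    _ ≤ m * m := by
        rw [Finset.card_product]
        have : (Finset.univ.image c).card ≤ m := Finset.card_image_le.trans (by simp)
        gcongr

/-- A set of darts that respects the orientation `upDarts` but is not a face contains many darts
of a short cycle. -/
lemma exists_subset_dartsOn_of_not_isFace {G : SimpleGraph (Fin n)}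
    {elt : Sym2 (Fin n) → Sym2 (Fin n) → Prop} {S : Finset G.Dart} (hS : S ⊆ upDarts G)
    (hnf : ¬ IsFace G elt S) :
    ∃ j ∈ Finset.Icc 2 S.card, ∃ m ∈ Finset.Icc (2 * j - 1) (2 * j), ∃ c ∈ pathMaps G m,
      ∃ T ⊆ S, T ⊆ dartsOn G c ∧ T.card = j := by
  classical
  have hanti : ¬ ∃ d ∈ (S : Set G.Dart), d.symm ∈ (S : Set G.Dart) := by
    rintro ⟨d, hd, hd'⟩
    have h1 := hS hd
    have h2 := hS hd'
    simp only [upDarts, Finset.mem_filter, Finset.mem_univ, true_and, Dart.symm_toProd,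
      Prod.fst_swap, Prod.snd_swap] at h1 h2
    exact h1.asymm h2
  have key : ∀ j, 2 ≤ j → ∀ (u : Fin n) (w : G.Walk u u), w.IsCycle →
      w.length ∈ Finset.Icc (2 * j - 1) (2 * j) → ∀ P : G.Dart → Prop,
      j ≤ Set.ncard {d | d ∈ (S : Set G.Dart) ∧ d ∈ w.darts ∧ P d} →
      ∃ j ∈ Finset.Icc 2 S.card, ∃ m ∈ Finset.Icc (2 * j - 1) (2 * j), ∃ c ∈ pathMaps G m,
        ∃ T ⊆ S, T ⊆ dartsOn G c ∧ T.card = j := by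
    intro j hj u w hw hm P hcard
    have hset : {d | d ∈ (S : Set G.Dart) ∧ d ∈ w.darts ∧ P d} =
        ((S.filter fun d => d ∈ w.darts ∧ P d : Finset G.Dart) : Set G.Dart) := by
      ext d; simp
    rw [hset, Set.ncard_coe_finset] at hcard
    obtain ⟨T, hT, hTc⟩ := Finset.exists_subset_card_eq hcard
    have hTS : T ⊆ S := hT.trans (Finset.filter_subset _ _)
    refine ⟨j, Finset.mem_Icc.2 ⟨hj, hTc ▸ Finset.card_le_card hTS⟩, w.length, hm, _,
      getVert_mem_pathMaps hw rfl, T, hTS, fun d hd => ?_, hTc⟩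
    have hdw := (Finset.mem_filter.1 (hT hd)).2.1
    exact Finset.mem_filter.2 ⟨hS (hTS hd),
      exists_getVert_of_mem_support hw rfl (w.dart_fst_mem_support_of_mem_darts hdw),
      exists_getVert_of_mem_support hw rfl (w.dart_snd_mem_support_of_mem_darts hdw)⟩
  rw [IsFace, and_iff_right hanti] at hnf
  push Not at hnf
  obtain ⟨j, hj, u, w, hw, h⟩ := hnf
  by_cases hodd : w.length = 2 * j - 1 → Set.ncard {d ∈ (S : Set G.Dart) | d ∈ w.darts} < j
  · obtain ⟨h1, h2⟩ := h hodd
    exact key j hj u w hw (by simp; omega) (fun d => ∃ e ∈ w.edges, elt e d.edge) h2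
  · push Not at hodd
    exact key j hj u w hw (by simp; omega) (fun _ => True) (by simpa using hodd.2)

lemma choose_le_numFaces_add (G : SimpleGraph (Fin n))
    (elt : Sym2 (Fin n) → Sym2 (Fin n) → Prop) (ℓ : ℕ) :
    G.edgeSet.ncard.choose ℓ ≤ numFaces G elt ℓ +
      ∑ j ∈ Finset.Icc 2 ℓ, ∑ m ∈ Finset.Icc (2 * j - 1) (2 * j),
        (pathMaps G m).ncard * (2 ^ (m * m) * G.edgeSet.ncard ^ (ℓ - j)) := by
  classical
  rw [← card_upDarts, ← Finset.card_powersetCard,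
    ← Finset.card_filter_add_card_filter_not (fun S : Finset G.Dart => IsFace G elt S)]
  refine add_le_add ?_ ?_
  · rw [numFaces, ← Set.ncard_coe_finset]
    refine Set.ncard_le_ncard_of_injOn (fun S : Finset G.Dart => (S : Set G.Dart)) ?_
      (fun _ _ _ _ h => Finset.coe_injective h) (Set.toFinite _)
    intro S hS
    simp only [Finset.coe_filter, Finset.mem_powersetCard, Set.mem_ofPred_eq] at hS
    exact ⟨by rw [Set.ncard_coe_finset]; exact hS.1.2, hS.2⟩
  · have hsub : ((upDarts G).powersetCard ℓ).filter (fun S : Finset G.Dart => ¬ IsFace G elt S) ⊆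
        (Finset.Icc 2 ℓ).biUnion fun j => (Finset.Icc (2 * j - 1) (2 * j)).biUnion fun m =>
          (pathMaps G m).toFinset.biUnion fun c => ((dartsOn G c).powerset).biUnion fun T =>
            ((upDarts G).powersetCard (ℓ - j)).image fun R => T ∪ R := by
      intro S hS
      simp only [Finset.mem_filter, Finset.mem_powersetCard] at hS
      obtain ⟨⟨hS1, hS2⟩, hS3⟩ := hS
      obtain ⟨j, hj, m, hm, c, hc, T, hTS, hTc, hTj⟩ :=
        exists_subset_dartsOn_of_not_isFace hS1 hS3
      rw [hS2] at hj
      simp only [Finset.mem_biUnion]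
      refine ⟨j, hj, m, hm, c, by simpa using hc, T, Finset.mem_powerset.2 hTc, ?_⟩
      refine Finset.mem_image.2 ⟨S \ T, Finset.mem_powersetCard.2
        ⟨Finset.sdiff_subset.trans hS1, ?_⟩, Finset.union_sdiff_of_subset hTS⟩
      rw [Finset.card_sdiff_of_subset hTS, hS2, hTj]
    refine (Finset.card_le_card hsub).trans ?_
    refine Finset.card_biUnion_le.trans (Finset.sum_le_sum fun j _ => ?_)
    refine Finset.card_biUnion_le.trans (Finset.sum_le_sum fun m _ => ?_)
    rw [Set.ncard_eq_toFinset_card']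
    refine Finset.card_biUnion_le_card_mul _ _ _ fun c _ => ?_
    refine (Finset.card_biUnion_le_card_mul _ _ ((upDarts G).card ^ (ℓ - j)) fun T _ => ?_).trans ?_
    · exact Finset.card_image_le.trans (by
        rw [Finset.card_powersetCard]; exact Nat.choose_le_pow _ _)
    · rw [Finset.card_powerset]
      gcongr
      · norm_num
      · exact card_dartsOn_le G c

end Faces

section Recursion

open Polynomial in
/-- The coefficient `[t^{n-1-ℓ}] (t+1)^i (t+2)^{n-1-2i}`. -/
noncomputable def gammaCoeff (n i ℓ : ℕ) : ℤ :=
  ((X + 1) ^ i * (X + 2) ^ (n - 1 - 2 * i) : ℤ[X]).coeff (n - 1 - ℓ)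

lemma gammaRG_zero (n : ℕ) (G : SimpleGraph (Fin n))
    (elt : Sym2 (Fin n) → Sym2 (Fin n) → Prop) : gammaRG n G elt 0 = 1 := by
  rw [gammaRG, Nat.strongRecOn_eq]
  simp

lemma gammaRG_eq_sub (n : ℕ) (G : SimpleGraph (Fin n))
    (elt : Sym2 (Fin n) → Sym2 (Fin n) → Prop) {ℓ : ℕ} (hℓ : ℓ ≠ 0) :
    gammaRG n G elt ℓ =
      numFaces G elt ℓ - ∑ i ∈ Finset.range ℓ, gammaRG n G elt i * gammaCoeff n i ℓ := by
  conv_lhs => rw [gammaRG, Nat.strongRecOn_eq]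
  rw [if_neg hℓ, Polynomial.finsetSum_coeff]
  simp only [Polynomial.coeff_C_mul]
  rw [← Finset.sum_attach (Finset.range ℓ)]
  rfl

lemma coeff_mul_pow_le_eval (P : Polynomial ℕ) (m x : ℕ) :
    P.coeff m * x ^ m ≤ P.eval x := by
  rw [Polynomial.eval_eq_sum_range]
  rcases le_or_gt m P.natDegree with h | h
  · exact Finset.single_le_sum (f := fun i => P.coeff i * x ^ i) (fun _ _ => Nat.zero_le _)
      (Finset.mem_range.2 (Nat.lt_succ_of_le h))
  · simp [Polynomial.coeff_eq_zero_of_natDegree_lt h]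

lemma abs_gammaCoeff_le {n i ℓ : ℕ} (hi : i ≤ ℓ) (hn : 2 * ℓ + 1 ≤ n) :
    |(gammaCoeff n i ℓ : ℝ)| ≤ Real.exp 2 * (n : ℝ) ^ (ℓ - i) := by
  set Q : Polynomial ℕ :=
    (Polynomial.X + 1) ^ i * (Polynomial.X + 2) ^ (n - 1 - 2 * i) with hQ
  have hcast : gammaCoeff n i ℓ = (Q.coeff (n - 1 - ℓ) : ℕ) := by
    have : (Q.map (Nat.castRingHom ℤ)).coeff (n - 1 - ℓ) = (Q.coeff (n - 1 - ℓ) : ℕ) := by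
      rw [Polynomial.coeff_map]; rfl
    rw [← this, gammaCoeff, hQ]
    simp
  have hn0 : (0 : ℝ) < n := by exact_mod_cast (by omega : 0 < n)
  have h1 : (Q.coeff (n - 1 - ℓ) : ℝ) * (n : ℝ) ^ (n - 1 - ℓ) ≤ ((n : ℝ) + 2) ^ (n - 1 - i) := by
    have h := coeff_mul_pow_le_eval Q (n - 1 - ℓ) n
    have h2 : Q.eval n ≤ (n + 2) ^ (n - 1 - i) := by
      calc Q.eval n = (n + 1) ^ i * (n + 2) ^ (n - 1 - 2 * i) := by simp [hQ]
        _ ≤ (n + 2) ^ i * (n + 2) ^ (n - 1 - 2 * i) := by gcongr; norm_num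
        _ = (n + 2) ^ (n - 1 - i) := by rw [← pow_add]; congr 1; omega
    exact_mod_cast h.trans h2
  have h2 : ((n : ℝ) + 2) ^ (n - 1 - i) ≤
      Real.exp 2 * (n : ℝ) ^ (ℓ - i) * (n : ℝ) ^ (n - 1 - ℓ) := by
    have e1 : (n : ℝ) + 2 ≤ n * Real.exp (2 / n) := by
      have := Real.add_one_le_exp (2 / (n : ℝ))
      calc (n : ℝ) + 2 = n * (2 / n + 1) := by field_simp; ring
        _ ≤ _ := by gcongr
    calc ((n : ℝ) + 2) ^ (n - 1 - i) ≤ (n * Real.exp (2 / n)) ^ (n - 1 - i) := by gcongr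
      _ = Real.exp ((n - 1 - i : ℕ) * (2 / n)) * (n : ℝ) ^ (n - 1 - i) := by
          rw [mul_pow, ← Real.exp_nat_mul, mul_comm]
      _ ≤ Real.exp 2 * (n : ℝ) ^ (n - 1 - i) := by
          gcongr
          have : ((n - 1 - i : ℕ) : ℝ) ≤ n := by exact_mod_cast (by omega)
          calc ((n - 1 - i : ℕ) : ℝ) * (2 / n) ≤ n * (2 / n) := by gcongr
            _ = 2 := by field_simp
      _ = _ := by rw [mul_assoc, ← pow_add]; congr 2; omega
  rw [hcast, Int.cast_natCast, Nat.abs_cast]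
  exact le_of_mul_le_mul_right (h1.trans h2) (by positivity)

end Recursion

section Asymptotics

open Asymptotics

/-- The graphs on `Fin n` whose number of edges is of order `n ^ (2 - β)` and that have few paths on
at most `2k` vertices. -/
def typicalGraphs (β : ℝ) (k n : ℕ) : Set (SimpleGraph (Fin n)) :=
  {G | (n : ℝ) ^ (2 - β) / 8 ≤ numEdges G ∧ numEdges G ≤ (n : ℝ) ^ (2 - β) ∧
    ∀ m ∈ Finset.range (2 * k + 1), ((pathMaps G m).ncard : ℝ) ≤
      (n : ℝ) ^ (β / 2) * ((n : ℝ) ^ m * ((n : ℝ) ^ (-β)) ^ (m - 1))}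

lemma le_erProb_typicalGraphs {β : ℝ} (hβ0 : 0 < β) {k n : ℕ} (hn : 2 ≤ n) :
    1 - (16 * (n : ℝ) ^ (-(2 - β)) + (2 * k + 1) * (n : ℝ) ^ (-(β / 2))) ≤
      erProb n ((n : ℝ) ^ (-β)) (typicalGraphs β k n) := by
  have hn1 : (1 : ℝ) ≤ n := by exact_mod_cast (by omega : 1 ≤ n)
  have hn2 : (2 : ℝ) ≤ n := by exact_mod_cast hn
  have hn0 : (0 : ℝ) < n := by linarith
  set p : ℝ := (n : ℝ) ^ (-β) with hp
  have hp0 : 0 < p := Real.rpow_pos_of_pos hn0 _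
  have hp1 : p ≤ 1 := Real.rpow_le_one_of_one_le_of_nonpos hn1 (by linarith)
  set μ : ℝ := n.choose 2 * p with hμ
  set r : ℝ := (n : ℝ) ^ (2 - β) with hr
  have hr0 : 0 < r := Real.rpow_pos_of_pos hn0 _
  have hrp : r = n ^ 2 * p := by
    rw [hr, hp, sub_eq_add_neg, Real.rpow_add hn0]; norm_num
  have hμ1 : r / 4 ≤ μ := by
    rw [hμ, hrp, Nat.cast_choose_two]
    have : (n : ℝ) ^ 2 / 4 ≤ n * (n - 1) / 2 := by nlinarith
    nlinarith
  have hμ2 : μ ≤ r / 2 := by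
    rw [hμ, hrp, Nat.cast_choose_two]
    have : (n : ℝ) * (n - 1) / 2 ≤ n ^ 2 / 2 := by nlinarith
    nlinarith
  have hμ0 : 0 < μ := by linarith
  set A : Set (SimpleGraph (Fin n)) := {G | (μ / 2) ^ 2 < (numEdges G - μ) ^ 2} with hA
  set T : ℕ → ℝ := fun m => (n : ℝ) ^ (β / 2) * ((n : ℝ) ^ m * p ^ (m - 1)) with hT
  set B : ℕ → Set (SimpleGraph (Fin n)) := fun m => {G | T m < ((pathMaps G m).ncard : ℝ)} with hB
  have hsub : (typicalGraphs β k n)ᶜ ⊆ A ∪ ⋃ m ∈ Finset.range (2 * k + 1), B m := by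
    intro G hG
    by_contra hcon
    simp only [Set.mem_union, not_or, Set.mem_iUnion, exists_prop, not_exists, not_and, hA, hB,
      Set.mem_ofPred_eq, not_lt] at hcon
    have habs := abs_le_of_sq_le_sq' hcon.1 (by positivity)
    exact hG ⟨by linarith [habs.1], by linarith [habs.2], hcon.2⟩
  have hPA : erProb n p A ≤ 16 * (n : ℝ) ^ (-(2 - β)) := by
    have h := erProb_numEdges_deviation_mul_le (n := n) hp0.le hp1 ((μ / 2) ^ 2)
    rw [← hμ] at h
    rw [Real.rpow_neg hn0.le, ← hr]
    have h' : erProb n p A * μ ≤ 4 := by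
      have : erProb n p A * μ * μ ≤ 4 * μ := by
        have : erProb n p A * (μ / 2) ^ 2 ≤ μ := h
        linarith
      exact le_of_mul_le_mul_right this hμ0
    have hA0 : 0 ≤ erProb n p A :=
      Finset.sum_nonneg fun G _ => Set.indicator_nonneg
        (fun G _ => graphWeight_nonneg hp0.le hp1 G) G
    rw [← div_eq_mul_inv, le_div_iff₀ hr0]
    nlinarith
  have hPB : ∀ m, erProb n p (B m) ≤ (n : ℝ) ^ (-(β / 2)) := by
    intro m
    have h := (erProb_lt_mul_le (n := n) hp0.le hp1 (X := fun G => ((pathMaps G m).ncard : ℝ))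
      (fun G => Nat.cast_nonneg _) (T m)).trans (erExp_ncard_pathMaps_le hp0.le hp1 m)
    have hpos : 0 < (n : ℝ) ^ m * p ^ (m - 1) := by positivity
    have hnβ : 0 < (n : ℝ) ^ (β / 2) := Real.rpow_pos_of_pos hn0 _
    rw [Real.rpow_neg hn0.le, ← one_div, le_div_iff₀ hnβ]
    refine le_of_mul_le_mul_right (a := (n : ℝ) ^ m * p ^ (m - 1)) ?_ hpos
    rw [one_mul, mul_assoc]
    exact h
  have h := (erProb_mono hp0.le hp1 hsub).trans ((erProb_union_le hp0.le hp1 _ _).trans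
    (add_le_add hPA ((erProb_biUnion_le hp0.le hp1 _ B).trans
      (Finset.sum_le_sum fun m _ => hPB m))))
  rw [erProb_compl, Finset.sum_const, Finset.card_range, nsmul_eq_mul] at h
  push_cast at h
  linarith

lemma tendsto_erProb_typicalGraphs {β : ℝ} (hβ0 : 0 < β) (hβ1 : β < 1) (k : ℕ) :
    Tendsto (fun n : ℕ => erProb n ((n : ℝ) ^ (-β)) (typicalGraphs β k n)) atTop (nhds 1) := by
  have h : ∀ {a : ℝ}, 0 < a → Tendsto (fun n : ℕ => (n : ℝ) ^ (-a)) atTop (nhds 0) :=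
    fun ha => (tendsto_rpow_neg_atTop ha).comp tendsto_natCast_atTop_atTop
  have h1 : Tendsto (fun n : ℕ => 1 - (16 * (n : ℝ) ^ (-(2 - β)) +
      (2 * k + 1) * (n : ℝ) ^ (-(β / 2)))) atTop (nhds 1) := by
    have := (((h (a := 2 - β) (by linarith)).const_mul 16).add
      ((h (a := β / 2) (by linarith)).const_mul (2 * (k : ℝ) + 1))).const_sub 1
    simpa using this
  refine tendsto_of_tendsto_of_tendsto_of_le_of_le' h1 tendsto_const_nhds ?_ ?_
  · filter_upwards [eventually_ge_atTop 2] with n hn using le_erProb_typicalGraphs hβ0 hn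
  · filter_upwards [eventually_ge_atTop 1] with n hn
    have hn1 : (1 : ℝ) ≤ n := by exact_mod_cast hn
    exact erProb_le_one (Real.rpow_nonneg (by linarith) _)
      (Real.rpow_le_one_of_one_le_of_nonpos hn1 (by linarith)) _

/-- The filter of typical graphs on `n` vertices, as `n → ∞`. -/
def typicalFilter (β : ℝ) (k : ℕ) : Filter (Σ n : ℕ, SimpleGraph (Fin n)) :=
  comap Sigma.fst atTop ⊓ 𝓟 {x | x.2 ∈ typicalGraphs β k x.1}

lemma tendsto_erProb_of_eventually_typicalFilter {β : ℝ} (hβ0 : 0 < β) (hβ1 : β < 1) {k : ℕ}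
    {A : ∀ n : ℕ, Set (SimpleGraph (Fin n))} (hA : ∀ᶠ x in typicalFilter β k, x.2 ∈ A x.1) :
    Tendsto (fun n : ℕ => erProb n ((n : ℝ) ^ (-β)) (A n)) atTop (nhds 1) := by
  rw [typicalFilter, eventually_inf_principal, eventually_comap] at hA
  have hp : ∀ᶠ n : ℕ in atTop, 0 ≤ (n : ℝ) ^ (-β) ∧ (n : ℝ) ^ (-β) ≤ 1 := by
    filter_upwards [eventually_ge_atTop 1] with n hn
    have hn1 : (1 : ℝ) ≤ n := by exact_mod_cast hn
    exact ⟨Real.rpow_nonneg (by linarith) _,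
      Real.rpow_le_one_of_one_le_of_nonpos hn1 (by linarith)⟩
  refine tendsto_of_tendsto_of_tendsto_of_le_of_le' (tendsto_erProb_typicalGraphs hβ0 hβ1 k)
    tendsto_const_nhds ?_ ?_
  · filter_upwards [hA, hp] with n hn hp
    exact erProb_mono hp.1 hp.2 fun G hG => hn ⟨n, G⟩ rfl hG
  · filter_upwards [hp] with n hp using erProb_le_one hp.1 hp.2 _

variable {β : ℝ} {k : ℕ}

lemma tendsto_fst_typicalFilter :
    Tendsto (fun x : Σ n : ℕ, SimpleGraph (Fin n) => x.1) (typicalFilter β k) atTop :=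
  tendsto_comap.mono_left inf_le_left

lemma tendsto_natCast_fst_typicalFilter :
    Tendsto (fun x : Σ n : ℕ, SimpleGraph (Fin n) => (x.1 : ℝ)) (typicalFilter β k) atTop :=
  tendsto_natCast_atTop_atTop.comp tendsto_fst_typicalFilter

lemma eventually_mem_typicalGraphs :
    ∀ᶠ x in typicalFilter β k, x.2 ∈ typicalGraphs β k x.1 :=
  (eventually_principal.2 fun _ h => h).filter_mono inf_le_right

lemma rpow_isLittleO_rpow_typicalFilter {a b : ℝ} (hab : a < b) :
    (fun x : Σ n : ℕ, SimpleGraph (Fin n) => (x.1 : ℝ) ^ a) =o[typicalFilter β k]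
      fun x => (x.1 : ℝ) ^ b := by
  have h : (fun y : ℝ => y ^ a) =o[atTop] fun y : ℝ => y ^ b := by
    refine (isLittleO_iff_tendsto' ?_).2 ?_
    · filter_upwards [eventually_gt_atTop 0] with y hy h
      exact absurd h (Real.rpow_pos_of_pos hy _).ne'
    · refine (tendsto_rpow_neg_atTop (sub_pos.2 hab)).congr' ?_
      filter_upwards [eventually_gt_atTop 0] with y hy
      rw [← Real.rpow_sub hy, neg_sub]
  exact h.comp_tendsto tendsto_natCast_fst_typicalFilter

variable (elt : ∀ n : ℕ, Sym2 (Fin n) → Sym2 (Fin n) → Prop)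

lemma numFaces_isBigO (ℓ : ℕ) :
    (fun x : Σ n : ℕ, SimpleGraph (Fin n) => (numFaces x.2 (elt x.1) ℓ : ℝ))
      =O[typicalFilter β k] fun x => (x.1 : ℝ) ^ ((2 - β) * ℓ) := by
  refine IsBigO.of_bound (2 ^ ℓ) ?_
  filter_upwards [eventually_mem_typicalGraphs] with x hx
  have h1 : (numFaces x.2 (elt x.1) ℓ : ℝ) ≤ (2 * numEdges x.2) ^ ℓ := by
    rw [numEdges]
    exact_mod_cast numFaces_le x.2 (elt x.1) ℓ
  have h0 : 0 ≤ numEdges x.2 := Nat.cast_nonneg _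
  rw [Real.norm_of_nonneg (Nat.cast_nonneg _),
    Real.norm_of_nonneg (Real.rpow_nonneg (Nat.cast_nonneg _) _),
    Real.rpow_mul_natCast (Nat.cast_nonneg _), ← mul_pow]
  exact h1.trans (by gcongr; exact hx.2.1)

/-- Non-faces are negligible in a typical graph. -/
lemma sum_ncard_pathMaps_le {n ℓ : ℕ} (hβ0 : 0 < β) (hβ1 : β < 1) (hℓ : ℓ ≤ k) (hn : 1 ≤ n)
    {G : SimpleGraph (Fin n)} (hG : G ∈ typicalGraphs β k n) :
    ∑ j ∈ Finset.Icc 2 ℓ, ∑ m ∈ Finset.Icc (2 * j - 1) (2 * j),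
        ((pathMaps G m).ncard : ℝ) * (2 ^ (m * m) * numEdges G ^ (ℓ - j)) ≤
      (∑ j ∈ Finset.Icc 2 ℓ, ∑ m ∈ Finset.Icc (2 * j - 1) (2 * j), 2 ^ (m * m)) *
        (n : ℝ) ^ ((2 - β) * ℓ - β / 2) := by
  have hn1 : (1 : ℝ) ≤ n := by exact_mod_cast hn
  have hn0 : (0 : ℝ) < n := by linarith
  simp only [Finset.sum_mul]
  refine Finset.sum_le_sum fun j hj => Finset.sum_le_sum fun m hm => ?_
  rw [Finset.mem_Icc] at hj hm
  have h1 := hG.2.2 m (Finset.mem_range.2 (by omega))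
  have h0 : 0 ≤ numEdges G := Nat.cast_nonneg _
  have h2 : numEdges G ^ (ℓ - j) ≤ (n : ℝ) ^ ((2 - β) * (ℓ - j)) := by
    rw [← Nat.cast_sub hj.2, Real.rpow_mul_natCast hn0.le]
    gcongr
    exact hG.2.1
  have h3 : (n : ℝ) ^ (β / 2) * ((n : ℝ) ^ m * ((n : ℝ) ^ (-β)) ^ (m - 1)) =
      (n : ℝ) ^ (β / 2 + (m + -β * (m - 1))) := by
    rw [← Real.rpow_mul_natCast hn0.le, ← Real.rpow_natCast, ← Real.rpow_add hn0,
      ← Real.rpow_add hn0, Nat.cast_sub (by omega), Nat.cast_one]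
  rw [h3] at h1
  calc ((pathMaps G m).ncard : ℝ) * (2 ^ (m * m) * numEdges G ^ (ℓ - j))
      ≤ (n : ℝ) ^ (β / 2 + (m + -β * (m - 1))) *
          (2 ^ (m * m) * (n : ℝ) ^ ((2 - β) * (ℓ - j))) := by gcongr
    _ = 2 ^ (m * m) * (n : ℝ) ^ (β / 2 + (m + -β * (m - 1)) + (2 - β) * (ℓ - j)) := by
        rw [Real.rpow_add hn0 _ ((2 - β) * (ℓ - j))]; ring
    _ ≤ 2 ^ (m * m) * (n : ℝ) ^ ((2 - β) * ℓ - β / 2) := by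
        gcongr
        have hj2 : (2 : ℝ) ≤ j := by exact_mod_cast hj.1
        have hm2 : (m : ℝ) ≤ 2 * j := by exact_mod_cast hm.2
        nlinarith [mul_le_mul_of_nonneg_left hm2 (sub_nonneg.2 hβ1.le),
          mul_le_mul_of_nonneg_left hj2 hβ0.le]

lemma exists_le_numFaces (hβ0 : 0 < β) (hβ1 : β < 1) {ℓ : ℕ} (hℓ : ℓ ≤ k) :
    ∃ c : ℝ, 0 < c ∧ ∀ᶠ x in typicalFilter β k,
      c * (x.1 : ℝ) ^ ((2 - β) * ℓ) ≤ (numFaces x.2 (elt x.1) ℓ : ℝ) := by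
  set a : ℝ := 1 / (16 ^ ℓ * ℓ.factorial) with ha
  have ha0 : 0 < a := by positivity
  set K : ℝ := ∑ j ∈ Finset.Icc 2 ℓ, ∑ m ∈ Finset.Icc (2 * j - 1) (2 * j), 2 ^ (m * m) with hK
  have hK0 : 0 ≤ K := Finset.sum_nonneg fun j _ => Finset.sum_nonneg fun m _ => by positivity
  refine ⟨a / 2, by positivity, ?_⟩
  have hsmall := (((rpow_isLittleO_rpow_typicalFilter (β := β) (k := k)
    (show (2 - β) * ℓ - β / 2 < (2 - β) * ℓ by linarith)).const_mul_left K).bound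
      (half_pos ha0))
  have hlarge : ∀ᶠ x in typicalFilter β k, 2 * (ℓ : ℝ) * 8 ≤ (x.1 : ℝ) ^ (2 - β) :=
    ((tendsto_rpow_atTop (by linarith)).comp
      tendsto_natCast_fst_typicalFilter).eventually_ge_atTop _
  filter_upwards [hsmall, hlarge, eventually_mem_typicalGraphs,
    tendsto_fst_typicalFilter.eventually_ge_atTop 1] with x hsm hla hG hn
  have hr0 : 0 ≤ (x.1 : ℝ) ^ ((2 - β) * ℓ) := Real.rpow_nonneg (Nat.cast_nonneg _) _
  rw [Real.norm_of_nonneg (mul_nonneg hK0 (Real.rpow_nonneg (Nat.cast_nonneg _) _)),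
    Real.norm_of_nonneg hr0] at hsm
  have hbad := sum_ncard_pathMaps_le hβ0 hβ1 hℓ hn hG
  have hchoose : a * (x.1 : ℝ) ^ ((2 - β) * ℓ) ≤ (x.2.edgeSet.ncard.choose ℓ : ℝ) := by
    have h1 : (((x.2.edgeSet.ncard + 1 - ℓ : ℕ) : ℝ)) ^ ℓ ≤
        ℓ.factorial * (x.2.edgeSet.ncard.choose ℓ : ℝ) := by
      have := Nat.pow_sub_le_descFactorial x.2.edgeSet.ncard ℓ
      rw [Nat.descFactorial_eq_factorial_mul_choose] at this
      exact_mod_cast this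
    have hM := hG.1
    have h2 : (x.1 : ℝ) ^ (2 - β) / 16 ≤ ((x.2.edgeSet.ncard + 1 - ℓ : ℕ) : ℝ) := by
      have h3 : (ℓ : ℝ) ≤ x.2.edgeSet.ncard := by
        have : (0 : ℝ) ≤ ℓ := Nat.cast_nonneg _
        rw [numEdges] at hM
        linarith
      have h4 : ℓ ≤ x.2.edgeSet.ncard := by exact_mod_cast h3
      rw [Nat.cast_sub (by omega)]
      push_cast
      rw [numEdges] at hM
      linarith
    have h3 : ((x.1 : ℝ) ^ (2 - β) / 16) ^ ℓ ≤
        ℓ.factorial * (x.2.edgeSet.ncard.choose ℓ : ℝ) :=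
      (pow_le_pow_left₀ (by positivity) h2 ℓ).trans h1
    rw [Real.rpow_mul_natCast (Nat.cast_nonneg _), ha, one_div_mul_eq_div,
      div_le_iff₀ (by positivity)]
    rw [div_pow, div_le_iff₀ (by positivity)] at h3
    linarith
  have hfaces : (x.2.edgeSet.ncard.choose ℓ : ℝ) ≤ numFaces x.2 (elt x.1) ℓ +
      ∑ j ∈ Finset.Icc 2 ℓ, ∑ m ∈ Finset.Icc (2 * j - 1) (2 * j),
        ((pathMaps x.2 m).ncard : ℝ) * (2 ^ (m * m) * numEdges x.2 ^ (ℓ - j)) := by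
    simp only [numEdges]
    exact_mod_cast choose_le_numFaces_add x.2 (elt x.1) ℓ
  linarith

lemma gammaCoeff_isBigO {i ℓ : ℕ} (hi : i ≤ ℓ) :
    (fun x : Σ n : ℕ, SimpleGraph (Fin n) => (gammaCoeff x.1 i ℓ : ℝ))
      =O[typicalFilter β k] fun x => (x.1 : ℝ) ^ ((ℓ : ℝ) - i) := by
  refine IsBigO.of_bound (Real.exp 2) ?_
  filter_upwards [tendsto_fst_typicalFilter.eventually_ge_atTop (2 * ℓ + 1)] with x hx
  rw [← Nat.cast_sub hi, Real.rpow_natCast, Real.norm_eq_abs,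
    Real.norm_of_nonneg (by positivity)]
  exact abs_gammaCoeff_le hi hx

lemma gammaRG_isBigO_and_exists_le (hβ0 : 0 < β) (hβ1 : β < 1) {ℓ : ℕ} (hℓ : ℓ ≤ k) :
    ((fun x : Σ n : ℕ, SimpleGraph (Fin n) => (gammaRG x.1 x.2 (elt x.1) ℓ : ℝ))
      =O[typicalFilter β k] fun x => (x.1 : ℝ) ^ ((2 - β) * ℓ)) ∧
    ∃ c : ℝ, 0 < c ∧ ∀ᶠ x in typicalFilter β k,
      c * (x.1 : ℝ) ^ ((2 - β) * ℓ) ≤ (gammaRG x.1 x.2 (elt x.1) ℓ : ℝ) := by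
  induction ℓ using Nat.strong_induction_on with
  | _ ℓ ih =>
    rcases eq_or_ne ℓ 0 with rfl | h0
    · simp only [gammaRG_zero, Nat.cast_zero, mul_zero, Real.rpow_zero, Int.cast_one]
      exact ⟨isBigO_refl _ _, 1, one_pos, by simp⟩
    have hcorr : (fun x : Σ n : ℕ, SimpleGraph (Fin n) => ∑ i ∈ Finset.range ℓ,
        (gammaRG x.1 x.2 (elt x.1) i : ℝ) * gammaCoeff x.1 i ℓ)
          =o[typicalFilter β k] fun x => (x.1 : ℝ) ^ ((2 - β) * ℓ) := by
      refine IsLittleO.fun_sum fun i hi => ?_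
      have hi' := Finset.mem_range.1 hi
      have hlt : (i : ℝ) < ℓ := by exact_mod_cast hi'
      refine (((ih i hi' (hi'.le.trans hℓ)).1.mul (gammaCoeff_isBigO hi'.le)).congr'
        EventuallyEq.rfl ?_).trans_isLittleO (rpow_isLittleO_rpow_typicalFilter
          (a := (2 - β) * i + (ℓ - i)) (by nlinarith))
      filter_upwards [tendsto_fst_typicalFilter.eventually_ge_atTop 1] with x hx
      rw [Real.rpow_add (by exact_mod_cast hx)]
    have heq : ∀ x : Σ n : ℕ, SimpleGraph (Fin n), (gammaRG x.1 x.2 (elt x.1) ℓ : ℝ) =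
        numFaces x.2 (elt x.1) ℓ - ∑ i ∈ Finset.range ℓ,
          (gammaRG x.1 x.2 (elt x.1) i : ℝ) * gammaCoeff x.1 i ℓ := by
      intro x
      rw [gammaRG_eq_sub _ _ _ h0]
      push_cast
      rfl
    simp only [heq]
    refine ⟨(numFaces_isBigO elt ℓ).sub hcorr.isBigO, ?_⟩
    obtain ⟨c, hc, hf⟩ := exists_le_numFaces elt hβ0 hβ1 hℓ
    refine ⟨c / 2, half_pos hc, ?_⟩
    filter_upwards [hf, hcorr.bound (half_pos hc)] with x h1 h2
    rw [Real.norm_eq_abs, Real.norm_of_nonneg (Real.rpow_nonneg (Nat.cast_nonneg _) _)] at h2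
    linarith [le_abs_self (∑ i ∈ Finset.range ℓ,
      (gammaRG x.1 x.2 (elt x.1) i : ℝ) * gammaCoeff x.1 i ℓ)]

lemma exists_gammaRG_bounds (hβ0 : 0 < β) (hβ1 : β < 1) :
    ∃ c C : ℝ, 0 < c ∧ c < C ∧ ∀ᶠ x in typicalFilter β k, ∀ ℓ ≤ k,
      c * (x.1 : ℝ) ^ ((2 - β) * ℓ) ≤ (gammaRG x.1 x.2 (elt x.1) ℓ : ℝ) ∧
        (gammaRG x.1 x.2 (elt x.1) ℓ : ℝ) ≤ C * (x.1 : ℝ) ^ ((2 - β) * ℓ) := by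
  have h : ∀ ℓ ∈ Finset.range (k + 1), ∃ d : ℝ, 0 < d ∧ ∃ D, ∀ᶠ x in typicalFilter β k,
      d * (x.1 : ℝ) ^ ((2 - β) * ℓ) ≤ (gammaRG x.1 x.2 (elt x.1) ℓ : ℝ) ∧
        (gammaRG x.1 x.2 (elt x.1) ℓ : ℝ) ≤ D * (x.1 : ℝ) ^ ((2 - β) * ℓ) := by
    intro ℓ hℓ
    obtain ⟨hO, d, hd, hle⟩ :=
      gammaRG_isBigO_and_exists_le (k := k) elt hβ0 hβ1 (Nat.lt_succ_iff.1 (Finset.mem_range.1 hℓ))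
    obtain ⟨D, hD⟩ := hO.bound
    refine ⟨d, hd, D, ?_⟩
    filter_upwards [hle, hD] with x h1 h2
    rw [Real.norm_eq_abs, Real.norm_of_nonneg (Real.rpow_nonneg (Nat.cast_nonneg _) _)] at h2
    exact ⟨h1, (le_abs_self _).trans h2⟩
  choose! d hd D hdD using h
  have hne : (Finset.range (k + 1)).Nonempty := ⟨0, by simp⟩
  set c := (Finset.range (k + 1)).inf' hne d with hc
  set C := max (c + 1) ((Finset.range (k + 1)).sup' hne D) with hC
  refine ⟨c, C, (Finset.lt_inf'_iff hne).2 hd, (lt_add_one c).trans_le (le_max_left _ _), ?_⟩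
  filter_upwards [(Filter.eventually_all_finset _).2 hdD] with x hx ℓ hℓ
  have hmem : ℓ ∈ Finset.range (k + 1) := Finset.mem_range.2 (Nat.lt_succ_of_le hℓ)
  have hr0 : 0 ≤ (x.1 : ℝ) ^ ((2 - β) * ℓ) := Real.rpow_nonneg (Nat.cast_nonneg _) _
  exact ⟨(mul_le_mul_of_nonneg_right (Finset.inf'_le _ hmem) hr0).trans (hx ℓ hmem).1,
    (hx ℓ hmem).2.trans (mul_le_mul_of_nonneg_right
      ((Finset.le_sup' _ hmem).trans (le_max_right _ _)) hr0)⟩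

end Asymptotics

open Filter in
theorem stmt17 (β : ℝ) (hβ0 : 0 < β) (hβ1 : β < 1) (k : ℕ) (hk : 1 ≤ k)
    (elt : ∀ n : ℕ, Sym2 (Fin n) → Sym2 (Fin n) → Prop)
    (hord : ∀ n, IsStrictTotalOrder (Sym2 (Fin n)) (elt n)) :
    (∃ c C : ℝ, 0 < c ∧ c < C ∧
      Tendsto (fun n => erProb n ((n : ℝ) ^ (-β))
          {G | ∀ ℓ ≤ k,
            c * (n : ℝ) ^ ((2 - β) * ℓ) ≤ (gammaRG n G (elt n) ℓ : ℝ) ∧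
              (gammaRG n G (elt n) ℓ : ℝ) ≤ C * (n : ℝ) ^ ((2 - β) * ℓ)})
        atTop (nhds 1)) ∧
    Tendsto (fun n => erProb n ((n : ℝ) ^ (-β))
        {G | ∀ ℓ, 1 ≤ ℓ → ℓ ≤ k → 0 < gammaRG n G (elt n) ℓ})
      atTop (nhds 1) := by
  obtain ⟨c, C, hc, hcC, h⟩ := exists_gammaRG_bounds (k := k) elt hβ0 hβ1
  refine ⟨⟨c, C, hc, hcC, tendsto_erProb_of_eventually_typicalFilter hβ0 hβ1 h⟩,
    tendsto_erProb_of_eventually_typicalFilter hβ0 hβ1 (k := k) ?_⟩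
  filter_upwards [h, tendsto_fst_typicalFilter.eventually_ge_atTop 1] with x hx hn ℓ _ hℓ
  have hpos : 0 < (x.1 : ℝ) ^ ((2 - β) * ℓ) := Real.rpow_pos_of_pos (by exact_mod_cast hn) _
  exact_mod_cast (mul_pos hc hpos).trans_le (hx ℓ hℓ).1

end SEP
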